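/- arXiv:2409.19195 — 2 statements merged into one kernel-verified Lean document; each statement's English description precedes it below -/
import Mathlib

section
/- Let k ≥ 0 be an integer, let w be a binary word of length n ≥ 1, and let v be a binary word of length n + k that does not contain w as a subword. Then Win(v,w;1/2) < 2/(1 + 2^k). -/
open scoped BigOperators

/-- Bernoulli(p) weight of a binary word `u`: `ℙ_p(u) = p^{‖u‖₁} (1-p)^{‖u‖₀}`. -/
noncomputable def wProb (p : ℝ) (u : List Bool) : ℝ :=
  p ^ (u.count true) * (1 - p) ^ (u.count false)

/-- Number of occurrences of `v` as a contiguous subword of `u`. -/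
def occCount (v u : List Bool) : ℕ :=
  (List.range (u.length + 1)).countP (fun i => decide (v <+: u.drop i))

/-- `Ω_{v,w}(v)`: binary words having `v` as a suffix, containing `v` exactly once
as a subword, and not containing `w` as a subword.  (`Ω_{v,w}(w) = OmegaWin w v`.) -/
def OmegaWin (v w : List Bool) : Set (List Bool) :=
  {u | v <:+ u ∧ occCount v u = 1 ∧ ¬ (w <:+: u)}

/-- The win probability `Win(v,w;p) = ∑_{u ∈ Ω_{v,w}(v)} ℙ_p(u)`. -/
noncomputable def Win (v w : List Bool) (p : ℝ) : ℝ :=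
  ∑' u : OmegaWin v w, wProb p u

/-- The correlation polynomial `vw_p = ∑_{u ∈ O(v,w)} ℙ_p(u)⁻¹`, where `O(v,w)` is
the set of nonempty words that are simultaneously a suffix of `v` and a prefix of `w`. -/
noncomputable def corr (v w : List Bool) (p : ℝ) : ℝ :=
  ∑ i ∈ Finset.Icc 1 w.length,
    if w.take i <:+ v then (wProb p (w.take i))⁻¹ else 0

/-- `Ω*_{v,w}(v) = {x : x ++ v ∈ Ω_{v,w}(v)}` (with `x` possibly empty). -/
def OmegaStarV (v w : List Bool) : Set (List Bool) :=
  {x | x ++ v ∈ OmegaWin v w}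

/-- Property `R`: `Ω*_{v,w}(v) = Ω*_{v,w}(w)`. -/
def PropR (v w : List Bool) : Prop :=
  OmegaStarV v w = {x | x ++ w ∈ OmegaWin w v}

/-- `D(v,w)`: nonempty proper prefixes `v₁⋯v_{n-k}` of `v` (`1 ≤ k ≤ n-1`) such that
`w₁⋯w_k = v_{n-k+1}⋯v_n`. -/
def Dset (v w : List Bool) : Set (List Bool) :=
  {x | ∃ k, 1 ≤ k ∧ k ≤ v.length - 1 ∧ k ≤ w.length ∧
    x = v.take (v.length - k) ∧ w.take k = v.drop (v.length - k)}

/-- `F(v,w) = D(v,v) ∪ D(w,w) ∪ D(w,v) ∪ D(v,w)`. -/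
def Fset (v w : List Bool) : Set (List Bool) :=
  Dset v v ∪ Dset w w ∪ Dset w v ∪ Dset v w

/-- `a^m`: concatenation of `m` copies of the word `a`. -/
def wpow (a : List Bool) (m : ℕ) : List Bool :=
  (List.replicate m a).flatten

open scoped ENNReal

theorem mem_OmegaWin_iff {v : List Bool} (hv : v ≠ []) (w u : List Bool) :
    u ∈ OmegaWin v w ↔ v <:+ u ∧ ¬ v <:+: u.dropLast ∧ ¬ w <:+: u := by
  have hcard : occCount v u = ((Finset.range (u.length + 1)).filter (fun i => v <+: u.drop i)).card :=
    List.countP_eq_length_filter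
  have hpos : 0 < v.length := List.length_pos_iff.mpr hv
  simp only [OmegaWin, Set.mem_ofPred_eq]
  refine and_congr_right fun hs => and_congr_left fun _ => ?_
  obtain ⟨p, rfl⟩ := hs
  rw [hcard, List.dropLast_append_of_ne_nil hv, Finset.card_eq_one]
  constructor
  · rintro ⟨a, ha⟩ ⟨s, t, hst⟩
    have hlen := congrArg List.length hst
    have h₁ : p.length ∈ ({a} : Finset ℕ) := by
      rw [← ha]; simp
    have h₂ : s.length ∈ ({a} : Finset ℕ) := by
      rw [← ha, Finset.mem_filter, Finset.mem_range]
      refine ⟨by simp at hlen ⊢; omega, ?_⟩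
      have : p ++ v = s ++ (v ++ (t ++ [v.getLast hv])) := by
        conv_lhs => rw [← List.dropLast_append_getLast hv, ← List.append_assoc, ← hst]
        simp
      rw [this, List.drop_left]
      exact List.prefix_append _ _
    simp at h₁ h₂ hlen
    omega
  · intro h
    refine ⟨p.length, ?_⟩
    ext i
    simp only [Finset.mem_filter, Finset.mem_range, Finset.mem_singleton]
    constructor
    · rintro ⟨hi, t, ht⟩
      by_cases htn : t = []
      · have := congrArg List.length ht
        simp [htn] at this
        omega
      · refine absurd ⟨(p ++ v).take i, t.dropLast, ?_⟩ h
        have : (p ++ v).take i ++ v ++ t = p ++ v := by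
          rw [List.append_assoc, ht, List.take_append_drop]
        rw [← List.dropLast_append_of_ne_nil htn, this, List.dropLast_append_of_ne_nil hv]
    · rintro rfl
      simp

/-- The uniform weight `2^{-|u|}` of a binary word, as an extended nonnegative real. -/
noncomputable def dyadicWeight (u : List Bool) : ℝ≥0∞ := 2⁻¹ ^ u.length

/-- The total uniform weight of a set of binary words. -/
noncomputable def dyadicMass (S : Set (List Bool)) : ℝ≥0∞ := ∑' u : S, dyadicWeight u

theorem dyadicWeight_append (u x : List Bool) :
    dyadicWeight (u ++ x) = dyadicWeight u * dyadicWeight x := by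
  simp [dyadicWeight, pow_add]

theorem two_pow_mul_dyadicWeight (x : List Bool) : 2 ^ x.length * dyadicWeight x = 1 := by
  rw [dyadicWeight, ← mul_pow, ENNReal.mul_inv_cancel (by simp) (by simp), one_pow]

theorem dyadicMass_mono {S T : Set (List Bool)} (h : S ⊆ T) : dyadicMass S ≤ dyadicMass T :=
  ENNReal.tsum_mono_subtype _ h

theorem dyadicMass_image_append (S : Set (List Bool)) (x : List Bool) :
    dyadicMass ((· ++ x) '' S) = dyadicMass S * dyadicWeight x := by
  rw [dyadicMass, tsum_image _ (List.append_left_injective x).injOn]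
  simp only [dyadicWeight_append, ENNReal.tsum_mul_right, dyadicMass]

theorem two_pow_mul_dyadicMass_image_append (S : Set (List Bool)) (x : List Bool) :
    2 ^ x.length * dyadicMass ((· ++ x) '' S) = dyadicMass S := by
  rw [dyadicMass_image_append, mul_left_comm, two_pow_mul_dyadicWeight, mul_one]

theorem dyadicMass_preimage_append_le (S : Set (List Bool)) (x : List Bool) :
    dyadicMass {u | u ++ x ∈ S} ≤ 2 ^ x.length * dyadicMass S := by
  rw [← two_pow_mul_dyadicMass_image_append _ x]
  gcongr
  apply dyadicMass_mono
  rintro _ ⟨u, hu, rfl⟩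
  exact hu

theorem dyadicMass_union {S T : Set (List Bool)} (h : Disjoint S T) :
    dyadicMass (S ∪ T) = dyadicMass S + dyadicMass T :=
  ENNReal.summable.tsum_union_disjoint h ENNReal.summable

theorem uniquelyDecodable_of_prefix_free {α : Type*} {S : Set (List α)} (hnil : [] ∉ S)
    (h : ∀ x ∈ S, ∀ y ∈ S, x <+: y → x = y) : InformationTheory.UniquelyDecodable S := by
  intro L₁
  induction L₁ with
  | nil =>
    rintro (_ | ⟨y, L₂⟩) _ h₂ heq
    · rfl
    · simp at heq
      exact absurd (heq.1 ▸ h₂ y (by simp)) hnil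
  | cons x L₁ ih =>
    rintro (_ | ⟨y, L₂⟩) h₁ h₂ heq
    · simp at heq
      exact absurd (heq.1 ▸ h₁ x (by simp)) hnil
    · have hx := h₁ x (by simp)
      have hy := h₂ y (by simp)
      simp only [List.flatten_cons] at heq
      have hxy : x = y := by
        rcases List.prefix_or_prefix_of_prefix (List.prefix_append x L₁.flatten)
          (heq ▸ List.prefix_append y L₂.flatten) with hp | hp
        · exact h x hx y hy hp
        · exact (h y hy x hx hp).symm
      subst hxy
      rw [ih L₂ (fun z hz => h₁ z (by simp [hz])) (fun z hz => h₂ z (by simp [hz]))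
        (List.append_cancel_left heq)]

theorem dyadicMass_le_one {S : Set (List Bool)} (hnil : [] ∉ S)
    (h : ∀ x ∈ S, ∀ y ∈ S, x <+: y → x = y) : dyadicMass S ≤ 1 := by
  rw [dyadicMass, tsum_subtype]
  refine ENNReal.summable.tsum_le_of_sum_le fun F => ?_
  classical
  rw [Finset.sum_indicator_eq_sum_filter F (fun _ => dyadicWeight) (fun _ => S) fun u => u]
  have hk := InformationTheory.kraft_mcmillan_inequality (S := F.filter (· ∈ S))
    (uniquelyDecodable_of_prefix_free (by simp [hnil]) fun x hx y hy =>
      h x (by simp_all) y (by simp_all))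
  rw [← ENNReal.toReal_le_toReal (ENNReal.sum_ne_top.mpr fun a _ => by simp [dyadicWeight])
    ENNReal.one_ne_top, ENNReal.toReal_sum fun a _ => by simp [dyadicWeight]]
  simpa [dyadicWeight] using hk

theorem win_half (v w : List Bool) : Win v w (1/2) = (dyadicMass (OmegaWin v w)).toReal := by
  rw [Win, dyadicMass, ENNReal.tsum_toReal_eq fun a => by simp [dyadicWeight]]
  refine tsum_congr fun u => ?_
  rw [wProb, show (1 - 1/2 : ℝ) = 1/2 by norm_num, ← pow_add, List.count_true_add_count_false]
  simp [dyadicWeight]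

/-- Words containing neither `v` nor `w`. -/
def avoidSet (v w : List Bool) : Set (List Bool) :=
  {u | ¬ v <:+: u ∧ ¬ w <:+: u}

theorem dropLast_mem_avoidSet {v w u : List Bool} (hv : v ≠ []) (h : u ∈ OmegaWin v w) :
    u.dropLast ∈ avoidSet v w :=
  have h' := (mem_OmegaWin_iff hv w u).mp h
  ⟨h'.2.1, fun hw => h'.2.2 (hw.trans u.dropLast_prefix.isInfix)⟩

theorem two_pow_mul_dyadicMass_OmegaWin_le {v : List Bool} (hv : v ≠ []) (w : List Bool) :
    2 ^ v.length * dyadicMass (OmegaWin v w) ≤ dyadicMass (avoidSet v w) := by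
  rw [← two_pow_mul_dyadicMass_image_append (avoidSet v w) v]
  gcongr
  apply dyadicMass_mono
  intro x hx
  obtain ⟨u, rfl⟩ := ((mem_OmegaWin_iff hv w x).mp hx).1
  have h := dropLast_mem_avoidSet hv hx
  rw [List.dropLast_append_of_ne_nil hv] at h
  exact ⟨u, ⟨fun hu => h.1 (hu.trans (List.prefix_append _ _).isInfix),
    fun hu => h.2 (hu.trans (List.prefix_append _ _).isInfix)⟩, rfl⟩

theorem exists_append_take_mem_OmegaWin {v w u : List Bool} (hv : v ≠ []) (hw : w ≠ [])
    (hle : w.length ≤ v.length) (hsub : ¬ w <:+: v) (hu : u ∈ avoidSet v w) :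
    (∃ i < w.length, u ++ w.take (i + 1) ∈ OmegaWin w v) ∨
      ∃ i < w.length - 1, u ++ w.take (i + 1) ∈ OmegaWin v w := by
  have hex : ∃ j, u ++ w.take j ∉ avoidSet v w :=
    ⟨w.length, fun h => h.2 (by simpa using (List.suffix_append u w).isInfix)⟩
  classical
  obtain ⟨i, hi⟩ : ∃ i, Nat.find hex = i + 1 :=
    Nat.exists_eq_succ_of_ne_zero fun h0 => by
      have := Nat.find_spec hex
      rw [h0] at this
      simp [hu] at this
  have hx : u ++ w.take (i + 1) ∉ avoidSet v w := hi ▸ Nat.find_spec hex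
  have hy : u ++ w.take i ∈ avoidSet v w := not_not.mp (Nat.find_min hex (by omega))
  have hilt : i < w.length := by
    by_contra! hge
    rw [List.take_of_length_le hge] at hy
    exact hy.2 (List.suffix_append u w).isInfix
  rw [List.take_succ_eq_append_getElem hilt, ← List.append_assoc] at hx
  have hsuf {z : List Bool} (hz : z <:+: u ++ w.take i ++ [w[i]])
      (hn : ¬ z <:+: u ++ w.take i) : z <:+ u ++ w.take i ++ [w[i]] :=
    (List.infix_concat_iff.mp hz).resolve_right hn
  by_cases hwx : w <:+: u ++ w.take i ++ [w[i]]
  · left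
    refine ⟨i, hilt, ?_⟩
    rw [List.take_succ_eq_append_getElem hilt, ← List.append_assoc, mem_OmegaWin_iff hw]
    refine ⟨hsuf hwx hy.2, List.dropLast_concat.symm ▸ hy.2, fun hvx => hsub ?_⟩
    exact (List.suffix_of_suffix_length_le (hsuf hwx hy.2) (hsuf hvx hy.1) hle).isInfix
  · right
    have hvx : v <:+: u ++ w.take i ++ [w[i]] := by
      by_contra hvx
      exact hx ⟨hvx, hwx⟩
    refine ⟨i, ?_, ?_⟩
    · by_contra! hge
      apply hwx
      rw [List.append_assoc, ← List.take_succ_eq_append_getElem hilt,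
        List.take_of_length_le (by omega)]
      exact (List.suffix_append u w).isInfix
    · rw [List.take_succ_eq_append_getElem hilt, ← List.append_assoc, mem_OmegaWin_iff hv]
      exact ⟨hsuf hvx hy.1, List.dropLast_concat.symm ▸ hy.1, hwx⟩

theorem dyadicMass_biUnion_append_take_le (S : Set (List Bool)) {w : List Bool} {m : ℕ}
    (hm : m ≤ w.length) :
    dyadicMass (⋃ i ∈ Finset.range m, {u | u ++ w.take (i + 1) ∈ S}) ≤
      (∑ i ∈ Finset.range m, 2 ^ (i + 1)) * dyadicMass S := by
  rw [Finset.sum_mul]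
  refine (ENNReal.tsum_biUnion_le _ _ _).trans (Finset.sum_le_sum fun i hi => ?_)
  refine (dyadicMass_preimage_append_le S _).trans_eq ?_
  rw [List.length_take_of_le (by have := Finset.mem_range.mp hi; omega)]

theorem dyadicMass_avoidSet_le {v w : List Bool} (hv : v ≠ []) (hw : w ≠ [])
    (hle : w.length ≤ v.length) (hsub : ¬ w <:+: v) :
    dyadicMass (avoidSet v w) ≤
      (∑ i ∈ Finset.range w.length, 2 ^ (i + 1)) * dyadicMass (OmegaWin w v) +
        (∑ i ∈ Finset.range (w.length - 1), 2 ^ (i + 1)) * dyadicMass (OmegaWin v w) := by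
  refine (dyadicMass_mono (T := (⋃ i ∈ Finset.range w.length,
    {u | u ++ w.take (i + 1) ∈ OmegaWin w v}) ∪ ⋃ i ∈ Finset.range (w.length - 1),
    {u | u ++ w.take (i + 1) ∈ OmegaWin v w}) fun u hu => ?_).trans
    ((ENNReal.tsum_union_le _ _ _).trans (add_le_add
      (dyadicMass_biUnion_append_take_le _ le_rfl)
      (dyadicMass_biUnion_append_take_le _ (Nat.sub_le _ _))))
  simpa using exists_append_take_mem_OmegaWin hv hw hle hsub hu

theorem dyadicMass_OmegaWin_add_le_one {v w : List Bool} (hv : v ≠ []) (hw : w ≠ []) :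
    dyadicMass (OmegaWin v w) + dyadicMass (OmegaWin w v) ≤ 1 := by
  have hdisj : Disjoint (OmegaWin v w) (OmegaWin w v) :=
    Set.disjoint_left.mpr fun u h₁ h₂ => h₁.2.2 h₂.1.isInfix
  rw [← dyadicMass_union hdisj]
  have hdrop {x : List Bool} (hx : x ∈ OmegaWin v w ∪ OmegaWin w v) :
      ¬ v <:+: x.dropLast ∧ ¬ w <:+: x.dropLast := by
    rcases hx with hx | hx
    · exact dropLast_mem_avoidSet hv hx
    · exact (dropLast_mem_avoidSet hw hx).symm
  refine dyadicMass_le_one ?_ fun x hx y hy hxy => ?_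
  · rintro (h | h)
    · exact hv (List.suffix_nil.mp h.1)
    · exact hw (List.suffix_nil.mp h.1)
  · by_contra hne
    obtain ⟨t, rfl⟩ := hxy
    have ht : t ≠ [] := by rintro rfl; simp at hne
    have hpre : x <:+: (x ++ t).dropLast := by
      rw [List.dropLast_append_of_ne_nil ht]
      exact (List.prefix_append _ _).isInfix
    rcases hx with hx | hx
    · exact (hdrop hy).1 (hx.1.isInfix.trans hpre)
    · exact (hdrop hy).2 (hx.1.isInfix.trans hpre)

theorem sum_range_two_pow_succ (m : ℕ) :
    ∑ i ∈ Finset.range m, (2 : ℝ) ^ (i + 1) = 2 ^ (m + 1) - 2 := by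
  induction m with
  | zero => norm_num
  | succ m ih => rw [Finset.sum_range_succ, ih]; ring

/-- At `p = 1/2`, a word `k` letters longer wins with probability less than `2/(1+2^k)`. -/
theorem stmt5 (k n : ℕ) (hn : 1 ≤ n) (w v : List Bool)
    (hw : w.length = n) (hv : v.length = n + k) (hsub : ¬ w <:+: v) :
    Win v w (1/2) < 2 / (1 + 2 ^ k) := by
  have hw0 : w ≠ [] := List.length_pos_iff.mp (by omega)
  have hv0 : v ≠ [] := List.length_pos_iff.mp (by omega)
  have hsum := dyadicMass_OmegaWin_add_le_one hv0 hw0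
  have hmain := (two_pow_mul_dyadicMass_OmegaWin_le hv0 w).trans
    (dyadicMass_avoidSet_le hv0 hw0 (by omega) hsub)
  rw [win_half]
  have hA : dyadicMass (OmegaWin v w) ≠ ∞ :=
    ne_top_of_le_ne_top ENNReal.one_ne_top (le_self_add.trans hsum)
  have hB : dyadicMass (OmegaWin w v) ≠ ∞ :=
    ne_top_of_le_ne_top ENNReal.one_ne_top (le_add_self.trans hsum)
  lift dyadicMass (OmegaWin v w) to NNReal using hA with a
  lift dyadicMass (OmegaWin w v) to NNReal using hB with b
  rw [hw, hv] at hmain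
  norm_cast at hsum hmain
  have hsum' : (a : ℝ) + b ≤ 1 := mod_cast hsum
  have hmain' : (2 : ℝ) ^ (n + k) * a ≤ (∑ i ∈ Finset.range n, (2 : ℝ) ^ (i + 1)) * b +
      (∑ i ∈ Finset.range (n - 1), (2 : ℝ) ^ (i + 1)) * a := mod_cast hmain
  rw [sum_range_two_pow_succ, sum_range_two_pow_succ, Nat.sub_add_cancel hn] at hmain'
  rw [ENNReal.coe_toReal, lt_div_iff₀ (by positivity)]
  have ha : (0 : ℝ) ≤ a := a.2
  have hN : (2 : ℝ) ≤ 2 ^ n := by simpa using pow_le_pow_right₀ (one_le_two (α := ℝ)) hn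
  have hK : (1 : ℝ) ≤ 2 ^ k := one_le_pow₀ one_le_two
  rw [pow_add, pow_succ] at hmain'
  generalize (2 : ℝ) ^ n = N at *
  generalize (2 : ℝ) ^ k = K at *
  have hle : (N * K + N) * a ≤ 2 * N - 2 := by
    nlinarith
  have : N * (a * (1 + K)) < N * 2 := by nlinarith
  exact lt_of_mul_lt_mul_left this (by linarith)
end

section
/- For any binary words v and w, the limit lim_{p→0⁺} Win(v,w;p) exists and belongs to the set {0, 1/2, 1}. -/
open scoped BigOperators

open scoped ENNReal

/-- The Bernoulli weight is multiplicative. -/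
theorem wProb_append (p : ℝ) (x y : List Bool) : wProb p (x ++ y) = wProb p x * wProb p y := by
  simp only [wProb, List.count_append, pow_add]
  ring

theorem wProb_pos {p : ℝ} (h0 : 0 < p) (h1 : p < 1) (x : List Bool) : 0 < wProb p x :=
  mul_pos (pow_pos h0 _) (pow_pos (sub_pos.2 h1) _)

/-- The total Bernoulli weight of a set of words. -/
noncomputable def mass (p : ℝ) (S : Set (List Bool)) : ℝ≥0∞ :=
  ∑' u : S, ENNReal.ofReal (wProb p u)

theorem mass_union (p : ℝ) {S T : Set (List Bool)} (h : Disjoint S T) :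
    mass p (S ∪ T) = mass p S + mass p T :=
  Summable.tsum_union_disjoint (f := fun u => ENNReal.ofReal (wProb p u)) h
    ENNReal.summable ENNReal.summable

theorem mass_mono (p : ℝ) {S T : Set (List Bool)} (h : S ⊆ T) : mass p S ≤ mass p T :=
  ENNReal.tsum_mono_subtype (fun u => ENNReal.ofReal (wProb p u)) h

theorem mass_singleton_nil (p : ℝ) : mass p {[]} = 1 := by
  simp [mass, wProb]

theorem mass_ne_top_of_finite (p : ℝ) {S : Set (List Bool)} (h : S.Finite) : mass p S ≠ ∞ := by
  have := h.fintype
  rw [mass, tsum_fintype]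
  exact ENNReal.sum_ne_top.2 fun _ _ => ENNReal.ofReal_ne_top

theorem mass_image_append {p : ℝ} (h0 : 0 < p) (h1 : p < 1) (S : Set (List Bool))
    (c : List Bool) :
    mass p ((fun x => x ++ c) '' S) = mass p S * ENNReal.ofReal (wProb p c) := by
  rw [mass, tsum_image (fun u => ENNReal.ofReal (wProb p u)) (List.append_left_injective c).injOn,
    mass, ← ENNReal.tsum_mul_right]
  refine tsum_congr fun x => ?_
  rw [wProb_append, ENNReal.ofReal_mul (wProb_pos h0 h1 _).le]

/-- The words that leave the set `N` exactly at their last letter. -/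
def exitSet (N : Set (List Bool)) : Set (List Bool) :=
  {u | u ∉ N ∧ u.dropLast ∈ N}

/-- A set of words containing the empty word and closed under taking prefixes. -/
structure IsPrefixTree (N : Set (List Bool)) : Prop where
  nil_mem : [] ∈ N
  mem_of_isPrefix : ∀ {x y : List Bool}, x <+: y → y ∈ N → x ∈ N

namespace IsPrefixTree

variable {N : Set (List Bool)} {p : ℝ}

theorem mass_add_mass_exitSet (hN : IsPrefixTree N) (h0 : 0 < p) (h1 : p < 1) :
    mass p N + mass p (exitSet N) = 1 + mass p N := by
  have key : N ∪ exitSet N =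
      {[]} ∪ ((fun x => x ++ [true]) '' N ∪ (fun x => x ++ [false]) '' N) := by
    ext u
    rcases List.eq_nil_or_concat u with rfl | ⟨x, b, rfl⟩
    · simp [hN.nil_mem]
    · have : x ++ [b] ∈ N → x ∈ N := hN.mem_of_isPrefix (List.prefix_append _ _)
      cases b <;> simp [exitSet] <;> tauto
  have hd : Disjoint N (exitSet N) := Set.disjoint_left.2 fun u hu hu' => hu'.1 hu
  have hd1 : Disjoint ((fun x => x ++ [true]) '' N) ((fun x => x ++ [false]) '' N) := by
    rw [Set.disjoint_left]
    rintro _ ⟨x, -, rfl⟩ ⟨y, -, h⟩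
    simp at h
  have hd2 : Disjoint {[]} ((fun x => x ++ [true]) '' N ∪ (fun x => x ++ [false]) '' N) := by
    simp
  rw [← mass_union p hd, key, mass_union p hd2, mass_union p hd1, mass_singleton_nil,
    mass_image_append h0 h1, mass_image_append h0 h1, ← mul_add,
    ← ENNReal.ofReal_add (wProb_pos h0 h1 _).le (wProb_pos h0 h1 _).le]
  simp [wProb]

theorem mass_exitSet_eq_one (hN : IsPrefixTree N) (h0 : 0 < p) (h1 : p < 1)
    (hfin : mass p N ≠ ∞) : mass p (exitSet N) = 1 := by
  have h := hN.mass_add_mass_exitSet h0 h1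
  rw [add_comm 1] at h
  exact (ENNReal.add_right_inj hfin).1 h

theorem mass_exitSet_le_one (hN : IsPrefixTree N) (h0 : 0 < p) (h1 : p < 1) :
    mass p (exitSet N) ≤ 1 := by
  rw [mass, ENNReal.tsum_eq_iSup_sum]
  refine iSup_le fun s => ?_
  set k := s.sup fun u => (u : List Bool).length
  set K : Set (List Bool) := {x ∈ N | x.length ≤ k}
  have hKtree : IsPrefixTree K :=
    ⟨⟨hN.nil_mem, Nat.zero_le _⟩,
      fun hxy hy => ⟨hN.mem_of_isPrefix hxy hy.1, hxy.length_le.trans hy.2⟩⟩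
  have hKfin : K.Finite := (List.finite_length_le Bool k).subset fun x hx => hx.2
  have hsub : (↑(s.map (Function.Embedding.subtype _)) : Set (List Bool)) ⊆ exitSet K := by
    intro u hu
    simp only [Finset.coe_map, Set.mem_image, Finset.mem_coe] at hu
    obtain ⟨a, ha, rfl⟩ := hu
    have hle : (a : List Bool).length ≤ k :=
      Finset.le_sup (f := fun u : exitSet N => (u : List Bool).length) ha
    refine ⟨fun h => a.2.1 h.1, a.2.2, ?_⟩
    simp only [Function.Embedding.subtype_apply, List.length_dropLast]
    omega
  calc ∑ a ∈ s, ENNReal.ofReal (wProb p a)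
      = mass p ↑(s.map (Function.Embedding.subtype _)) := by
        rw [mass, Finset.tsum_subtype' (s.map (Function.Embedding.subtype _))
          fun u => ENNReal.ofReal (wProb p u), Finset.sum_map]
        rfl
    _ ≤ mass p (exitSet K) := mass_mono p hsub
    _ = 1 := hKtree.mass_exitSet_eq_one h0 h1 (mass_ne_top_of_finite p hKfin)

theorem _root_.List.dropLast_take_of_le {α : Type*} {l : List α} {i : ℕ} (h : i ≤ l.length) :
    (l.take i).dropLast = l.take (i - 1) := by
  rw [List.dropLast_eq_take, List.take_take, List.length_take, min_eq_left h,
    min_eq_left (Nat.sub_le _ _)]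

/-- Following a word that always leads out of `N`, there is exactly one exit time. -/
theorem mass_eq_sum (hN : IsPrefixTree N) (h0 : 0 < p) (h1 : p < 1) {v : List Bool}
    (hv : ∀ x, x ++ v ∉ N) :
    mass p N = ∑ i ∈ Finset.Icc 1 v.length,
      mass p {y ∈ exitSet N | v.take i <:+ y} * (ENNReal.ofReal (wProb p (v.take i)))⁻¹ := by
  classical
  have hmul : ∀ c : List Bool, mass p {y ∈ exitSet N | c <:+ y} *
      (ENNReal.ofReal (wProb p c))⁻¹ = mass p {x | x ++ c ∈ exitSet N} := by
    intro c
    have : {y ∈ exitSet N | c <:+ y} = (fun x => x ++ c) '' {x | x ++ c ∈ exitSet N} := by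
      ext y
      constructor
      · rintro ⟨h, x, rfl⟩
        exact ⟨x, h, rfl⟩
      · rintro ⟨x, h, rfl⟩
        exact ⟨h, x, rfl⟩
    rw [this, mass_image_append h0 h1, mul_assoc, ENNReal.mul_inv_cancel, mul_one]
    · simpa using wProb_pos h0 h1 c
    · exact ENNReal.ofReal_ne_top
  simp only [hmul]
  simp only [mass, tsum_subtype _ (fun u => ENNReal.ofReal (wProb p u))]
  rw [← Summable.tsum_finsetSum fun _ _ => ENNReal.summable]
  refine tsum_congr fun x => ?_
  -- every shorter extension than an exiting one is still in `N`
  have hstep : ∀ i j, i < j → x ++ v.take j ∈ exitSet N → j ≤ v.length → x ++ v.take i ∈ N := by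
    intro i j hij hj hjl
    refine hN.mem_of_isPrefix ?_ hj.2
    rw [List.dropLast_append_of_ne_nil, List.dropLast_take_of_le hjl]
    · refine (List.prefix_append_right_inj x).2 (List.take_prefix_take_left (by omega))
    · intro h
      have := congrArg List.length h
      rw [List.length_take, List.length_nil] at this
      omega
  by_cases hx : x ∈ N
  · have hex : ∃ i, x ++ v.take i ∉ N := ⟨v.length, by simpa using hv x⟩
    set k := Nat.find hex
    have hkN : x ++ v.take k ∉ N := Nat.find_spec hex
    have hk0 : 1 ≤ k := by
      by_contra h
      have : k = 0 := by omega
      rw [this] at hkN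
      simp [hx] at hkN
    have hkl : k ≤ v.length := Nat.find_min' hex (by simpa using hv x)
    have hkT : x ++ v.take k ∈ exitSet N := by
      refine ⟨hkN, ?_⟩
      have := Nat.find_min hex (m := k - 1) (by omega)
      rw [List.dropLast_append_of_ne_nil, List.dropLast_take_of_le hkl]
      · simpa using this
      · intro h
        have := congrArg List.length h
        rw [List.length_take, List.length_nil] at this
        omega
    rw [Finset.sum_eq_single k]
    · have hxk : x ∈ {x | x ++ v.take k ∈ exitSet N} := hkT
      rw [Set.indicator_of_mem hx, Set.indicator_of_mem hxk]
    · intro j hj hjk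
      rw [Finset.mem_Icc] at hj
      refine Set.indicator_of_notMem (fun hjT => ?_) _
      rcases lt_or_gt_of_ne hjk with h | h
      · exact hjT.1 (hstep j k h hkT hkl)
      · exact hkN (hstep k j h hjT hj.2)
    · intro h
      exact absurd (Finset.mem_Icc.2 ⟨hk0, hkl⟩) h
  · rw [Set.indicator_of_notMem hx]
    symm
    refine Finset.sum_eq_zero fun j hj => Set.indicator_of_notMem (fun hjT => hx ?_) _
    rw [Finset.mem_Icc] at hj
    simpa using hstep 0 j hj.1 hjT hj.2

theorem mass_ne_top (hN : IsPrefixTree N) (h0 : 0 < p) (h1 : p < 1) {v : List Bool}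
    (hv : ∀ x, x ++ v ∉ N) : mass p N ≠ ∞ := by
  rw [hN.mass_eq_sum h0 h1 hv]
  refine ENNReal.sum_ne_top.2 fun i _ => ENNReal.mul_ne_top ?_ ?_
  · exact ne_top_of_le_ne_top ENNReal.one_ne_top
      ((mass_mono p fun _ h => h.1).trans (hN.mass_exitSet_le_one h0 h1))
  · simpa using wProb_pos h0 h1 _

end IsPrefixTree

theorem isPrefixTree_avoidSet {v w : List Bool} (hv : v ≠ []) (hw : w ≠ []) :
    IsPrefixTree (avoidSet v w) :=
  ⟨by simp [avoidSet, hv, hw],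
    fun hxy hy => ⟨fun h => hy.1 (h.trans hxy.isInfix), fun h => hy.2 (h.trans hxy.isInfix)⟩⟩

theorem List.infix_iff_suffix_or_infix_dropLast {α : Type*} {v u : List α} (hv : v ≠ []) :
    v <:+: u ↔ v <:+ u ∨ v <:+: u.dropLast := by
  rcases List.eq_nil_or_concat u with rfl | ⟨x, b, rfl⟩
  · simp [hv]
  · rw [List.concat_eq_append, List.infix_concat_iff, List.dropLast_concat]

theorem occCount_eq_card (v u : List Bool) :
    occCount v u = ((Finset.range (u.length + 1)).filter fun i => v <+: u.drop i).card := by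
  rw [occCount, List.countP_eq_length_filter]
  rfl

theorem occCount_eq_one_iff {v u : List Bool} (hv : v ≠ []) (h : v <:+ u) :
    occCount v u = 1 ↔ ¬ v <:+: u.dropLast := by
  rw [occCount_eq_card]
  obtain ⟨x, rfl⟩ := h
  have hmem : x.length ∈
      (Finset.range ((x ++ v).length + 1)).filter fun i => v <+: (x ++ v).drop i := by
    simp
  have hd : (x ++ v).dropLast = x ++ v.dropLast := List.dropLast_append_of_ne_nil hv
  have hpos := List.length_pos_iff.2 hv
  constructor
  · rintro hc ⟨s, t, hst⟩
    obtain ⟨i, hi⟩ := Finset.card_eq_one.1 hc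
    have hs : s.length ∈
        (Finset.range ((x ++ v).length + 1)).filter fun i => v <+: (x ++ v).drop i := by
      have hlen := congrArg List.length hst
      simp only [List.length_append, List.length_dropLast] at hlen
      rw [Finset.mem_filter, Finset.mem_range, List.length_append]
      refine ⟨by omega, ?_⟩
      rw [← List.dropLast_concat_getLast (l := x ++ v) (by simp [hv]), ← hst]
      simp
    rw [hi, Finset.mem_singleton] at hmem hs
    have hlen := congrArg List.length hst
    simp only [List.length_append, List.length_dropLast] at hlen
    omega
  · intro hn
    refine Finset.card_eq_one.2 ⟨x.length, Finset.eq_singleton_iff_unique_mem.2 ⟨hmem, ?_⟩⟩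
    intro j hj
    rw [Finset.mem_filter] at hj
    have hle := hj.2.length_le
    rw [List.length_drop, List.length_append] at hle
    by_contra hne
    refine hn ?_
    obtain ⟨t, ht⟩ := hj.2
    have htne : t ≠ [] := by
      rintro rfl
      have := congrArg List.length ht
      simp at this
      omega
    refine ⟨(x ++ v).take j, t.dropLast, ?_⟩
    rw [List.append_assoc, ← List.dropLast_append_of_ne_nil htne, ht,
      ← List.dropLast_append_of_ne_nil, List.take_append_drop]
    intro h
    have := congrArg List.length h
    simp at this
    omega

/-- The words in which `w` completes the first occurrence of `v` or `w`. -/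
def hitSet (v w : List Bool) : Set (List Bool) :=
  {u ∈ exitSet (avoidSet v w) | w <:+ u}

theorem omegaWin_eq {v w : List Bool} (hv : v ≠ []) (hw : w ≠ []) :
    OmegaWin v w = {u ∈ exitSet (avoidSet v w) | v <:+ u ∧ ¬ w <:+ u} := by
  ext u
  constructor
  · rintro ⟨h1, h2, h3⟩
    rw [occCount_eq_one_iff hv h1] at h2
    rw [List.infix_iff_suffix_or_infix_dropLast hw] at h3
    push Not at h3
    exact ⟨⟨fun h => h.1 h1.isInfix, h2, h3.2⟩, h1, h3.1⟩
  · rintro ⟨⟨-, h1, h2⟩, h3, h4⟩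
    refine ⟨h3, (occCount_eq_one_iff hv h3).2 h1, ?_⟩
    rw [List.infix_iff_suffix_or_infix_dropLast hw]
    tauto

theorem exitSet_avoidSet_eq {v w : List Bool} (hv : v ≠ []) (hw : w ≠ []) :
    exitSet (avoidSet v w) = OmegaWin v w ∪ hitSet v w := by
  ext u
  rw [omegaWin_eq hv hw]
  constructor
  · intro h
    by_cases h' : w <:+ u
    · exact Or.inr ⟨h, h'⟩
    · refine Or.inl ⟨h, ?_, h'⟩
      by_contra h''
      refine h.1 ⟨?_, ?_⟩
      · rw [List.infix_iff_suffix_or_infix_dropLast hv]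
        exact not_or.2 ⟨h'', h.2.1⟩
      · rw [List.infix_iff_suffix_or_infix_dropLast hw]
        exact not_or.2 ⟨h', h.2.2⟩
  · rintro (h | h)
    · exact h.1
    · exact h.1

theorem disjoint_omegaWin_hitSet {v w : List Bool} :
    Disjoint (OmegaWin v w) (hitSet v w) :=
  Set.disjoint_left.2 fun _ h h' => h.2.2 h'.2.isInfix

theorem mass_omegaWin_add_mass_hitSet {p : ℝ} (h0 : 0 < p) (h1 : p < 1) {v w : List Bool}
    (hv : v ≠ []) (hw : w ≠ []) : mass p (OmegaWin v w) + mass p (hitSet v w) = 1 := by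
  have hN := isPrefixTree_avoidSet hv hw
  rw [← mass_union p disjoint_omegaWin_hitSet, ← exitSet_avoidSet_eq hv hw]
  exact hN.mass_exitSet_eq_one h0 h1
    (hN.mass_ne_top h0 h1 (v := v) fun x hx => hx.1 (List.suffix_append x v).isInfix)

theorem win_eq_toReal_mass {p : ℝ} (h0 : 0 < p) (h1 : p < 1) (v w : List Bool) :
    Win v w p = (mass p (OmegaWin v w)).toReal := by
  rw [Win, mass, ENNReal.tsum_toReal_eq fun _ => ENNReal.ofReal_ne_top]
  exact tsum_congr fun u => (ENNReal.toReal_ofReal (wProb_pos h0 h1 _).le).symm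

theorem mass_hitSet_toReal {p : ℝ} (h0 : 0 < p) (h1 : p < 1) {v w : List Bool}
    (hv : v ≠ []) (hw : w ≠ []) : (mass p (hitSet v w)).toReal = 1 - Win v w p := by
  have h := mass_omegaWin_add_mass_hitSet h0 h1 hv hw
  have ht : mass p (OmegaWin v w) ≠ ∞ := ne_top_of_le_ne_top ENNReal.one_ne_top
    (h ▸ le_self_add)
  have ht' : mass p (hitSet v w) ≠ ∞ := ne_top_of_le_ne_top ENNReal.one_ne_top
    (h ▸ le_add_self)
  rw [win_eq_toReal_mass h0 h1, eq_sub_iff_add_eq', ← ENNReal.toReal_add ht ht', h,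
    ENNReal.toReal_one]

/-- The expected waiting time expressed through correlations with a word `z` that
overlaps first hits only within the word completing the hit. -/
theorem mass_avoidSet_toReal {p : ℝ} (h0 : 0 < p) (h1 : p < 1) {v w z : List Bool}
    (hv : v ≠ []) (hw : w ≠ []) (hz : ∀ x, x ++ z ∉ avoidSet v w)
    (hvz : ∀ i ∈ Finset.Icc 1 z.length, ∀ y ∈ OmegaWin v w, z.take i <:+ y → z.take i <:+ v)
    (hwz : ∀ i ∈ Finset.Icc 1 z.length, ∀ y ∈ hitSet v w, z.take i <:+ y → z.take i <:+ w) :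
    (mass p (avoidSet v w)).toReal =
      Win v w p * corr v z p + (1 - Win v w p) * corr w z p := by
  have hN := isPrefixTree_avoidSet hv hw
  have h := mass_omegaWin_add_mass_hitSet h0 h1 hv hw
  have hsub : ∀ S ⊆ exitSet (avoidSet v w), mass p S ≠ ∞ := fun S hS =>
    ne_top_of_le_ne_top ENNReal.one_ne_top
      ((mass_mono p hS).trans (hN.mass_exitSet_le_one h0 h1))
  have hA : OmegaWin v w ⊆ exitSet (avoidSet v w) := by
    rw [exitSet_avoidSet_eq hv hw]
    exact Set.subset_union_left
  rw [hN.mass_eq_sum h0 h1 hz, ENNReal.toReal_sum, corr, corr, Finset.mul_sum, Finset.mul_sum,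
    ← Finset.sum_add_distrib]
  · refine Finset.sum_congr rfl fun i hi => ?_
    set c := z.take i
    have hsplit : {y ∈ exitSet (avoidSet v w) | c <:+ y} =
        {y ∈ OmegaWin v w | c <:+ v} ∪ {y ∈ hitSet v w | c <:+ w} := by
      ext y
      rw [exitSet_avoidSet_eq hv hw]
      constructor
      · rintro ⟨hy | hy, hc⟩
        · exact Or.inl ⟨hy, hvz i hi y hy hc⟩
        · exact Or.inr ⟨hy, hwz i hi y hy hc⟩
      · rintro (⟨hy, hc⟩ | ⟨hy, hc⟩)
        · exact ⟨Or.inl hy, hc.trans hy.1⟩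
        · exact ⟨Or.inr hy, hc.trans hy.2⟩
    have hd : Disjoint {y ∈ OmegaWin v w | c <:+ v} {y ∈ hitSet v w | c <:+ w} :=
      disjoint_omegaWin_hitSet.mono (fun _ h => h.1) (fun _ h => h.1)
    rw [hsplit, mass_union p hd, ENNReal.toReal_mul,
      ENNReal.toReal_add (hsub _ fun y hy => hA hy.1) (hsub _ fun y hy => hy.1.1),
      ENNReal.toReal_inv, ENNReal.toReal_ofReal (wProb_pos h0 h1 _).le,
      ← mass_hitSet_toReal h0 h1 hv hw, win_eq_toReal_mass h0 h1]
    have hempty : mass p ∅ = 0 := by simp [mass]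
    by_cases hcv : c <:+ v <;> by_cases hcw : c <:+ w <;> simp [hcv, hcw, hempty, add_mul]
  · intro i _
    refine ENNReal.mul_ne_top (hsub _ fun y hy => hy.1) ?_
    simpa using wProb_pos h0 h1 _

/-- Conway's formula, also valid when `v` is a suffix of `w`. -/
theorem win_mul_corr_sub {p : ℝ} (h0 : 0 < p) (h1 : p < 1) {v w : List Bool}
    (hv : v ≠ []) (hw : w ≠ []) (hwv : ¬ w <:+: v) (hvw : ¬ v <:+: w.dropLast) :
    Win v w p * (corr v v p - corr v w p) =
      (1 - Win v w p) * (corr w w p - corr w v p) := by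
  have e1 := mass_avoidSet_toReal h0 h1 hv hw (z := v)
    (fun x hx => hx.1 (List.suffix_append x v).isInfix)
    (fun i _ y hy hc => List.suffix_of_suffix_length_le hc hy.1 (List.length_take_le' _ _))
    (fun i _ y hy hc => by
      rcases List.suffix_or_suffix_of_suffix hc hy.2 with h | h
      · exact h
      · exact absurd (h.isInfix.trans (List.take_prefix _ _).isInfix) hwv)
  have e2 := mass_avoidSet_toReal h0 h1 hv hw (z := w)
    (fun x hx => hx.2 (List.suffix_append x w).isInfix)
    (fun i hi y hy hc => by
      rcases List.suffix_or_suffix_of_suffix hc hy.1 with h | h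
      · exact h
      · rw [Finset.mem_Icc] at hi
        rcases hi.2.eq_or_lt with rfl | hlt
        · rw [List.take_length] at hc
          exact absurd hc.isInfix hy.2.2
        · refine absurd (h.isInfix.trans (List.IsPrefix.isInfix ?_)) hvw
          rw [List.dropLast_eq_take]
          exact List.take_prefix_take_left (by omega))
    (fun i _ y hy hc => List.suffix_of_suffix_length_le hc hy.2 (List.length_take_le' _ _))
  linear_combination e2 - e1

open Filter Topology

theorem tendsto_pow_mul_inv_wProb {u : List Bool} {k : ℕ} (h : u.count true ≤ k) :
    Tendsto (fun p : ℝ => p ^ k * (wProb p u)⁻¹) (𝓝[>] 0)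
      (𝓝 (if u.count true = k then 1 else 0)) := by
  have hcont : ContinuousAt
      (fun p : ℝ => p ^ (k - u.count true) * ((1 - p) ^ u.count false)⁻¹) 0 :=
    ContinuousAt.mul (by fun_prop) (ContinuousAt.inv₀ (by fun_prop) (by simp))
  have hval : (0 : ℝ) ^ (k - u.count true) * ((1 - 0) ^ u.count false)⁻¹ =
      if u.count true = k then 1 else 0 := by
    rcases h.eq_or_lt with h | h
    · simp [h]
    · simp [h.ne, Nat.sub_ne_zero_of_lt h]
  rw [← hval]
  refine (hcont.tendsto.mono_left nhdsWithin_le_nhds).congr' ?_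
  filter_upwards [self_mem_nhdsWithin] with p hp
  have hp : p ≠ 0 := (Set.mem_Ioi.1 hp).ne'
  rw [wProb, mul_inv, ← mul_assoc, pow_sub₀ p hp h]

/-- The number of nonempty words with exactly `k` ones that are simultaneously a suffix of `v`
and a prefix of `w`. -/
def overlapCount (v w : List Bool) (k : ℕ) : ℕ :=
  ((Finset.Icc 1 w.length).filter fun i => w.take i <:+ v ∧ (w.take i).count true = k).card

theorem tendsto_pow_mul_corr {v w : List Bool} {k : ℕ} (h : v.count true ≤ k) :
    Tendsto (fun p : ℝ => p ^ k * corr v w p) (𝓝[>] 0) (𝓝 (overlapCount v w k)) := by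
  simp only [corr, Finset.mul_sum]
  rw [overlapCount, Finset.card_filter, Nat.cast_sum]
  refine tendsto_finsetSum _ fun i _ => ?_
  by_cases hi : w.take i <:+ v
  · simpa [hi] using tendsto_pow_mul_inv_wProb ((hi.sublist.count_le true).trans h)
  · simp [hi]

theorem overlapCount_eq_zero_left {v w : List Bool} {k : ℕ} (h : v.count true < k) :
    overlapCount v w k = 0 := by
  rw [overlapCount, Finset.card_eq_zero, Finset.filter_eq_empty_iff]
  rintro i - ⟨hi, hk⟩
  have := hi.sublist.count_le true
  omega

theorem overlapCount_eq_zero_right {v w : List Bool} {k : ℕ} (h : w.count true < k) :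
    overlapCount v w k = 0 := by
  rw [overlapCount, Finset.card_eq_zero, Finset.filter_eq_empty_iff]
  rintro i - ⟨-, hk⟩
  have := (List.take_sublist i w).count_le true
  omega

theorem overlapCount_self_pos {v : List Bool} (hv : v ≠ []) :
    0 < overlapCount v v (v.count true) := by
  refine Finset.card_pos.2 ⟨v.length, ?_⟩
  simpa [Nat.one_le_iff_ne_zero] using hv

/-- Prepending zeros delays the first one. -/
theorem idxOf_true_append {r y : List Bool} (h : (r ++ y).count true = y.count true) :
    (r ++ y).idxOf true = r.length + y.idxOf true := by
  have hr : true ∉ r := by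
    rw [← List.count_eq_zero]
    rw [List.count_append] at h
    omega
  rw [List.idxOf_append, if_neg hr, add_comm]

theorem overlapCount_le_one {v w : List Bool} (h : 0 < v.count true) :
    overlapCount v w (v.count true) ≤ 1 := by
  have key : ∀ i j, i < j → j ≤ w.length → w.take i <:+ v → w.take j <:+ v →
      (w.take i).count true = v.count true → (w.take j).count true = v.count true → False := by
    intro i j hij hj hi' hj' hic hjc
    have hs : w.take i <:+ w.take j :=
      List.suffix_of_suffix_length_le hi' hj' (by simp; omega)
    obtain ⟨r, hr⟩ := hs
    obtain ⟨s, hs⟩ : w.take i <+: w.take j := List.take_prefix_take_left hij.le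
    have e1 := idxOf_true_append (r := r) (y := w.take i) (by rw [hr, hic, hjc])
    have e2 := List.idxOf_append_of_mem (l₂ := s) (a := true) (l₁ := w.take i)
      (List.count_pos_iff.1 (by omega))
    rw [hr] at e1
    rw [hs] at e2
    have := congrArg List.length hr
    simp only [List.length_append, List.length_take] at this
    omega
  refine Finset.card_le_one.2 fun i hi j hj => ?_
  simp only [Finset.mem_filter, Finset.mem_Icc] at hi hj
  rcases lt_trichotomy i j with hij | hij | hij
  · exact (key i j hij hj.1.2 hi.2.1 hj.2.1 hi.2.2 hj.2.2).elim
  · exact hij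
  · exact (key j i hij hi.1.2 hj.2.1 hi.2.1 hj.2.2 hi.2.2).elim

/-- An overlap containing all ones of both words pins down their numbers of leading zeros. -/
theorem exists_of_overlapCount_pos {v w : List Bool} {k : ℕ} (hk : 0 < k)
    (hv : v.count true = k) (h : 0 < overlapCount v w k) :
    ∃ r y, v = r ++ y ∧ y <+: w ∧ v.idxOf true = r.length + w.idxOf true := by
  obtain ⟨i, hi⟩ := Finset.card_pos.1 h
  simp only [Finset.mem_filter] at hi
  obtain ⟨-, ⟨r, hr⟩, hc⟩ := hi
  refine ⟨r, w.take i, hr.symm, List.take_prefix i w, ?_⟩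
  have e := List.idxOf_append_of_mem (l₂ := w.drop i) (a := true) (l₁ := w.take i)
    (List.count_pos_iff.1 (by omega))
  rw [List.take_append_drop] at e
  rw [e, ← hr, idxOf_true_append (by rw [hr, hv, hc])]

theorem infix_of_overlapCount_pos {v w : List Bool} {k : ℕ} (hk : 0 < k)
    (hv : v.count true = k) (hw : w.count true = k) (hvw : 0 < overlapCount v w k)
    (hwv : 0 < overlapCount w v k) : w <:+: v := by
  obtain ⟨r, y, -, -, h1⟩ := exists_of_overlapCount_pos hk hv hvw
  obtain ⟨s, z, rfl, hz, h2⟩ := exists_of_overlapCount_pos hk hw hwv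
  obtain rfl : s = [] := List.length_eq_zero_iff.1 (by omega)
  exact hz.isInfix

theorem count_true_pos_of_not_isInfix {v w : List Bool} (hw : w ≠ []) (hwv : ¬ w <:+: v)
    (hvw : ¬ v <:+: w.dropLast) (h : v.count true = w.count true) : 0 < v.count true := by
  by_contra h0
  have hzero : ∀ u : List Bool, u.count true = 0 → u = List.replicate u.length false := by
    intro u hu
    refine List.eq_replicate_iff.2 ⟨rfl, fun b hb => ?_⟩
    cases b
    · rfl
    · exact absurd hb (List.count_eq_zero.1 hu)
  have hv' := hzero v (by omega)
  have hw' := hzero w (by omega)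
  have hpos := List.length_pos_iff.2 hw
  rcases le_or_gt w.length v.length with hl | hl
  · refine hwv (List.IsPrefix.isInfix ⟨List.replicate (v.length - w.length) false, ?_⟩)
    rw [hv', hw', List.replicate_append_replicate]
    simp [hl]
  · refine hvw (List.IsPrefix.isInfix ⟨List.replicate (w.length - 1 - v.length) false, ?_⟩)
    rw [hv', hw', List.replicate_append_replicate, List.dropLast_replicate]
    simp only [List.length_replicate]
    congr 1
    omega

theorem tendsto_win {v w : List Bool} {k : ℕ} (hv : v ≠ []) (hw : w ≠ [])
    (hwv : ¬ w <:+: v) (hvw : ¬ v <:+: w.dropLast) (hvk : v.count true ≤ k)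
    (hwk : w.count true ≤ k) {a b : ℝ} (ha : (overlapCount w w k : ℝ) - overlapCount w v k = a)
    (hb : (overlapCount v v k : ℝ) - overlapCount v w k = b) (hab : a + b ≠ 0) :
    Tendsto (fun p => Win v w p) (𝓝[>] 0) (𝓝 (a / (a + b))) := by
  have hf := (tendsto_pow_mul_corr (w := w) hwk).sub (tendsto_pow_mul_corr (w := v) hwk)
  have hg := (tendsto_pow_mul_corr (w := v) hvk).sub (tendsto_pow_mul_corr (w := w) hvk)
  rw [ha] at hf
  rw [hb] at hg
  have hfg := hf.add hg
  refine (hf.div hfg hab).congr' ?_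
  filter_upwards [hfg.eventually_ne hab, Ioo_mem_nhdsGT (zero_lt_one' ℝ)] with p hp hp'
  rw [Pi.div_apply, div_eq_iff hp]
  linear_combination -p ^ k * win_mul_corr_sub hp'.1 hp'.2 hv hw hwv hvw

theorem win_eq_zero_of_isInfix {v w : List Bool} (h : w <:+: v) (p : ℝ) : Win v w p = 0 := by
  have : IsEmpty (OmegaWin v w) := ⟨fun u => u.2.2.2 (h.trans u.2.1.isInfix)⟩
  exact tsum_empty

theorem win_eq_one_of_infix_dropLast {v w : List Bool} (hv : v ≠ []) (hw : w ≠ [])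
    (h : v <:+: w.dropLast) {p : ℝ} (h0 : 0 < p) (h1 : p < 1) : Win v w p = 1 := by
  have hempty : hitSet v w = ∅ := by
    refine Set.eq_empty_of_forall_notMem ?_
    rintro _ ⟨hu, x, rfl⟩
    refine hu.2.1 (h.trans ?_)
    rw [List.dropLast_append_of_ne_nil hw]
    exact (List.suffix_append _ _).isInfix
  have := mass_hitSet_toReal h0 h1 hv hw
  rw [hempty] at this
  simp only [mass, tsum_empty, ENNReal.toReal_zero] at this
  linarith

/-- As `p → 0⁺`, the win probability converges to one of `0`, `1/2`, `1`. -/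
theorem stmt7 (v w : List Bool) (hv : v ≠ []) (hw : w ≠ []) :
    ∃ L ∈ ({0, 1/2, 1} : Set ℝ),
      Filter.Tendsto (fun p => Win v w p) (nhdsWithin 0 (Set.Ioi 0)) (nhds L) := by
  by_cases hwv : w <:+: v
  · exact ⟨0, by simp, by simp [win_eq_zero_of_isInfix hwv]⟩
  by_cases hvw : v <:+: w.dropLast
  · refine ⟨1, by simp, tendsto_const_nhds.congr' ?_⟩
    filter_upwards [Ioo_mem_nhdsGT (zero_lt_one' ℝ)] with p hp
    exact (win_eq_one_of_infix_dropLast hv hw hvw hp.1 hp.2).symm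
  rcases lt_trichotomy (v.count true) (w.count true) with h | h | h
  · have hpos : (0 : ℝ) < overlapCount w w (w.count true) :=
      Nat.cast_pos.2 (overlapCount_self_pos hw)
    have ht := tendsto_win hv hw hwv hvw h.le le_rfl rfl rfl
    simp only [overlapCount_eq_zero_right h, overlapCount_eq_zero_left h, Nat.cast_zero, sub_zero,
      add_zero, div_self hpos.ne'] at ht
    exact ⟨1, by simp, ht hpos.ne'⟩
  · have hk := count_true_pos_of_not_isInfix hw hwv hvw h
    have hvv : overlapCount v v (v.count true) = 1 :=
      le_antisymm (overlapCount_le_one hk) (overlapCount_self_pos hv)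
    have hww : overlapCount w w (v.count true) = 1 := by
      rw [h]
      exact le_antisymm (overlapCount_le_one (h ▸ hk)) (overlapCount_self_pos hw)
    have hvw1 : overlapCount v w (v.count true) ≤ 1 := overlapCount_le_one hk
    have hwv1 : overlapCount w v (v.count true) ≤ 1 := by
      rw [h]
      exact overlapCount_le_one (h ▸ hk)
    have ht := tendsto_win hv hw hwv hvw le_rfl h.ge rfl rfl
    rw [hvv, hww] at ht
    rcases Nat.le_one_iff_eq_zero_or_eq_one.1 hvw1 with h1 | h1 <;>
      rcases Nat.le_one_iff_eq_zero_or_eq_one.1 hwv1 with h2 | h2 <;> rw [h1, h2] at ht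
    · exact ⟨1 / 2, by simp, by convert ht (by norm_num) using 2; norm_num⟩
    · exact ⟨0, by simp, by convert ht (by norm_num) using 2; norm_num⟩
    · exact ⟨1, by simp, by convert ht (by norm_num) using 2; norm_num⟩
    · exact absurd (infix_of_overlapCount_pos hk rfl h.symm (by omega) (by omega)) hwv
  · have hpos : (0 : ℝ) < overlapCount v v (v.count true) :=
      Nat.cast_pos.2 (overlapCount_self_pos hv)
    have ht := tendsto_win hv hw hwv hvw le_rfl h.le rfl rfl
    simp only [overlapCount_eq_zero_right h, overlapCount_eq_zero_left h, Nat.cast_zero, sub_zero,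
      zero_add, zero_div] at ht
    exact ⟨0, by simp, ht hpos.ne'⟩
end
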